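/- arXiv:1609.00523 — 7 statements merged into one kernel-verified Lean document; each statement's English description precedes it below -/
import Mathlib

section
/- Let S be a finite set of points in d-dimensional Euclidean space with at least two elements, let v be a point (the position of a single mobile point), and suppose the closed ball with center c and radius r is the smallest enclosing ball of S ∪ {v}. Then for any subset S' ⊆ S with at least two elements, the following are equivalent: (i) c lies on the farthest-point Voronoi face F(S'), i.e. dist(c, s) = dist(c, s') for all s, s' ∈ S' and dist(c, s'') < dist(c, s) for all s ∈ S' and s'' ∈ S \ S'; (ii) S' = {s ∈ S : dist(c, s) = r}, i.e. S' is exactly the set of points of S lying on the boundary sphere of the smallest enclosing ball. -/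
/-- If a closed ball of radius `r` is a smallest enclosing ball of `A ∪ {v}`, then `A` does not
fit into a concentric ball of smaller radius: otherwise moving the center towards `v` would
give a smaller enclosing ball. -/
theorem le_of_smallest_enclosing_ball_union_singleton {E : Type*} [SeminormedAddCommGroup E]
    [NormedSpace ℝ E] {A : Set E} {v c : E} {r ρ : ℝ}
    (hsub : A ∪ {v} ⊆ Metric.closedBall c r)
    (hmin : ∀ (c' : E) (r' : ℝ), A ∪ {v} ⊆ Metric.closedBall c' r' → r ≤ r')
    (hρ : 0 ≤ ρ) (hA : ∀ a ∈ A, dist c a ≤ ρ) : r ≤ ρ := by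
  by_contra! hlt
  have hr : 0 < r := hρ.trans_lt hlt
  have hv : dist c v ≤ r := by
    simpa [dist_comm] using hsub (Or.inr rfl : v ∈ A ∪ {v})
  set t : ℝ := (r - ρ) / (2 * r) with ht
  have htr : t * r = (r - ρ) / 2 := by rw [ht]; field_simp
  have ht0 : 0 ≤ t := div_nonneg (by linarith) (by linarith)
  have ht1 : 0 ≤ 1 - t := by
    rw [sub_nonneg, ht, div_le_one (by linarith)]
    linarith
  have key := hmin (AffineMap.lineMap c v t) ((r + ρ) / 2) (by
    rintro x (hx | rfl)
    · have h1 : dist (AffineMap.lineMap c v t) c ≤ t * r := by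
        rw [dist_lineMap_left, Real.norm_of_nonneg ht0]
        exact mul_le_mul_of_nonneg_left hv ht0
      rw [Metric.mem_closedBall, dist_comm]
      linarith [dist_triangle (AffineMap.lineMap c v t) c x, hA x hx]
    · rw [Metric.mem_closedBall, dist_comm, dist_lineMap_right, Real.norm_of_nonneg ht1]
      linarith [mul_le_mul_of_nonneg_left hv ht1])
  linarith


/-- For a finite set `S` of at least two static points and a single
mobile point `v`, with smallest enclosing ball of `S ∪ {v}` the closed ball of
center `c` and radius `r`, a subset `S' ⊆ S` with `|S'| ≥ 2` satisfies: `c` lies on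
the farthest-point Voronoi face `F(S')` iff `S'` is exactly the set of points of `S`
on the boundary sphere of the smallest enclosing ball. -/
theorem one_center_on_fpvd_face_iff {d : ℕ}
    (S : Finset (EuclideanSpace ℝ (Fin d))) (hS : 2 ≤ S.card)
    (v : EuclideanSpace ℝ (Fin d))
    (c : EuclideanSpace ℝ (Fin d)) (r : ℝ)
    (hsub : ((↑S ∪ {v}) : Set (EuclideanSpace ℝ (Fin d))) ⊆ Metric.closedBall c r)
    (hmin : ∀ (c' : EuclideanSpace ℝ (Fin d)) (r' : ℝ),
      ((↑S ∪ {v}) : Set (EuclideanSpace ℝ (Fin d))) ⊆ Metric.closedBall c' r' → r ≤ r')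
    (S' : Finset (EuclideanSpace ℝ (Fin d))) (hS'sub : S' ⊆ S) (hS' : 2 ≤ S'.card) :
    ((∀ s ∈ S', ∀ s' ∈ S', dist c s = dist c s') ∧
      (∀ s ∈ S', ∀ s'' ∈ S, s'' ∉ S' → dist c s'' < dist c s))
    ↔ (∀ s ∈ S, (s ∈ S' ↔ dist c s = r)) := by
  have hle : ∀ s ∈ S, dist c s ≤ r := fun s hs => by
    simpa [dist_comm] using hsub (Or.inl hs)
  constructor
  · rintro ⟨heq, hlt⟩
    obtain ⟨p, hp⟩ := Finset.card_pos.mp (Nat.zero_lt_of_lt hS')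
    have hpr : dist c p = r := by
      refine (hle p (hS'sub hp)).antisymm
        (le_of_smallest_enclosing_ball_union_singleton hsub hmin dist_nonneg fun s hs => ?_)
      by_cases h : s ∈ S'
      · exact (heq s h p hp).le
      · exact (hlt p hp s hs h).le
    refine fun s hs => ⟨fun h => (heq s h p hp).trans hpr, fun h => ?_⟩
    by_contra hn
    exact (hlt p hp s hs hn).ne (h.trans hpr.symm)
  · intro h
    have hr : ∀ s ∈ S', dist c s = r := fun s hs => (h s (hS'sub hs)).mp hs
    refine ⟨fun s hs s' hs' => (hr s hs).trans (hr s' hs').symm, fun s hs s'' hs'' hn => ?_⟩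
    rw [hr s hs]
    exact (hle s'' hs'').lt_of_ne fun he => hn ((h s'' hs'').mpr he)
end

section
/- Let S be a finite set of at least two points in d-dimensional Euclidean space and suppose the closed ball B₀ with center c₀ and radius r₀ is the smallest enclosing ball of S. Let T = {s ∈ S : dist(c₀, s) = r₀} be the set of points of S on the boundary sphere of B₀. Then B₀ is also the smallest enclosing ball of T: T ⊆ closedBall c₀ r₀ and every closed ball containing T has radius at least r₀. (In particular, since T lies on the sphere of center c₀ and radius r₀, B₀ is the circumball of T.) -/
open Filter Topology in
/-- Moving the center of a ball slightly towards `c'` brings every point `s` of the ball strictly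
closer than `r`, provided that `s` is closer than `r` to `c'` if it lies on the boundary. -/
theorem eventually_dist_lineMap_lt {E : Type*} [SeminormedAddCommGroup E] [NormedSpace ℝ E]
    {s c c' : E} {r : ℝ} (hs : dist s c ≤ r) (hs' : dist s c = r → dist s c' < r) :
    ∀ᶠ t : ℝ in 𝓝[>] 0, dist s (AffineMap.lineMap c c' t) < r := by
  rcases hs.lt_or_eq with h | h
  · have hcont : Continuous fun t : ℝ => dist s (AffineMap.lineMap c c' t) :=
      continuous_const.dist AffineMap.lineMap_continuous
    exact (hcont.continuousAt.eventually_lt continuousAt_const (by simpa using h)).filter_mono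
      nhdsWithin_le_nhds
  · filter_upwards [Ioc_mem_nhdsGT (zero_lt_one (α := ℝ))] with t ht
    have hconv := (convexOn_dist s (convex_univ (𝕜 := ℝ) (E := E))).2 (Set.mem_univ c)
      (Set.mem_univ c') (sub_nonneg.2 ht.2) ht.1.le (sub_add_cancel 1 t)
    rw [AffineMap.lineMap_apply_module]
    simp only [smul_eq_mul, dist_comm _ s, h] at hconv
    linarith [mul_lt_mul_of_pos_left (hs' h) ht.1]

/-- The smallest enclosing ball of a finite set `S` of at least two
points is also the smallest enclosing ball (hence the circumball) of the set `T` of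
points of `S` lying on its boundary sphere. -/
theorem seb_eq_seb_of_boundary_points {d : ℕ}
    (S : Finset (EuclideanSpace ℝ (Fin d))) (hS : 2 ≤ S.card)
    (c₀ : EuclideanSpace ℝ (Fin d)) (r₀ : ℝ)
    (hsub : (↑S : Set (EuclideanSpace ℝ (Fin d))) ⊆ Metric.closedBall c₀ r₀)
    (hmin : ∀ (c' : EuclideanSpace ℝ (Fin d)) (r' : ℝ),
      (↑S : Set (EuclideanSpace ℝ (Fin d))) ⊆ Metric.closedBall c' r' → r₀ ≤ r')
    (T : Set (EuclideanSpace ℝ (Fin d)))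
    (hT : T = {s : EuclideanSpace ℝ (Fin d) | s ∈ S ∧ dist c₀ s = r₀}) :
    T ⊆ Metric.closedBall c₀ r₀ ∧
      ∀ (c' : EuclideanSpace ℝ (Fin d)) (r' : ℝ),
        T ⊆ Metric.closedBall c' r' → r₀ ≤ r' := by
  subst hT
  refine ⟨fun s hs => hsub hs.1, fun c' r' hT' => ?_⟩
  by_contra! hlt
  have hev : ∀ᶠ t : ℝ in nhdsWithin 0 (Set.Ioi 0),
      ∀ s ∈ S, dist s (AffineMap.lineMap c₀ c' t) < r₀ :=
    (Filter.eventually_all_finset S).2 fun s hs =>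
      eventually_dist_lineMap_lt (hsub hs) fun h =>
        (Metric.mem_closedBall.1 (hT' ⟨hs, by rwa [dist_comm]⟩)).trans_lt hlt
  obtain ⟨t, ht⟩ := hev.exists
  obtain ⟨m, hm, hmax⟩ := S.exists_max_image (fun s => dist s (AffineMap.lineMap c₀ c' t))
    (Finset.card_pos.1 (by lia))
  exact (ht m hm).not_ge (hmin _ _ hmax)
end

section
/- The smallest enclosing ball of a finite nonempty set of points in d-dimensional Euclidean space is unique: if S is a finite nonempty set, r is the minimal radius of a closed ball containing S (i.e. S ⊆ closedBall c₁ r, S ⊆ closedBall c₂ r, and every closed ball containing S has radius ≥ r), then c₁ = c₂. -/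
/-- Uniqueness of the smallest enclosing ball of a finite nonempty set:
if `r` is the minimal radius of a closed ball containing `S` and both
`closedBall c₁ r` and `closedBall c₂ r` contain `S`, then `c₁ = c₂`. -/
theorem seb_center_unique {d : ℕ}
    (S : Set (EuclideanSpace ℝ (Fin d))) (hfin : S.Finite) (hne : S.Nonempty)
    (c₁ c₂ : EuclideanSpace ℝ (Fin d)) (r : ℝ)
    (h₁ : S ⊆ Metric.closedBall c₁ r)
    (h₂ : S ⊆ Metric.closedBall c₂ r)
    (hmin : ∀ (c' : EuclideanSpace ℝ (Fin d)) (r' : ℝ),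
      S ⊆ Metric.closedBall c' r' → r ≤ r') :
    c₁ = c₂ := by
  have key : ∀ x ∈ S, dist x (midpoint ℝ c₁ c₂) ^ 2 ≤ r ^ 2 - (dist c₁ c₂ / 2) ^ 2 := by
    intro x hx
    have hx₁ : dist x c₁ ^ 2 ≤ r ^ 2 := pow_le_pow_left₀ dist_nonneg (h₁ hx) 2
    have hx₂ : dist x c₂ ^ 2 ≤ r ^ 2 := pow_le_pow_left₀ dist_nonneg (h₂ hx) 2
    have := EuclideanGeometry.dist_sq_add_dist_sq_eq_two_mul_dist_midpoint_sq_add_half_dist_sq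
      x c₁ c₂
    linarith
  obtain ⟨x, hx⟩ := hne
  have hr : 0 ≤ r := dist_nonneg.trans (h₁ hx)
  have hle := hmin (midpoint ℝ c₁ c₂) (√(r ^ 2 - (dist c₁ c₂ / 2) ^ 2))
    fun y hy ↦ Real.le_sqrt_of_sq_le (key y hy)
  rw [Real.le_sqrt hr ((sq_nonneg _).trans (key x hx))] at hle
  have hsq : dist c₁ c₂ ^ 2 = 0 := by linarith [sq_nonneg (dist c₁ c₂)]
  exact dist_eq_zero.mp (pow_eq_zero_iff two_ne_zero |>.mp hsq)
end

section
/- Let S be a finite set of points in d-dimensional Euclidean space containing at least two distinct points, and suppose the closed ball with center c and radius r is the smallest enclosing ball of S. Then the boundary sphere of this ball contains at least two points of S: there exist s₁, s₂ ∈ S with s₁ ≠ s₂ and dist(c, s₁) = dist(c, s₂) = r. -/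
open Filter Topology in
/-- If every point of a finite set other than `p` lies in the open ball of center `c` and positive
radius `r`, and `p` lies in the closed ball, then moving the center slightly towards `p` puts the
whole set into an open ball of radius `r`. -/
theorem exists_center_forall_dist_lt {E : Type*} [NormedAddCommGroup E] [NormedSpace ℝ E]
    (S : Finset E) {c p : E} {r : ℝ} (hr : 0 < r) (hp : dist p c ≤ r)
    (hlt : ∀ s ∈ S, s ≠ p → dist s c < r) :
    ∃ c' : E, ∀ s ∈ S, dist s c' < r := by
  have hev : ∀ᶠ t : ℝ in 𝓝[>] 0, ∀ s ∈ S, dist s (AffineMap.lineMap c p t) < r := by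
    rw [Filter.eventually_all_finset]
    intro s hs
    by_cases hsp : s = p
    · subst hsp
      filter_upwards [Ioo_mem_nhdsGT (zero_lt_one' ℝ)] with t ht
      rw [dist_comm, dist_lineMap_right, Real.norm_of_nonneg (by linarith [ht.2]), dist_comm]
      calc (1 - t) * dist s c ≤ (1 - t) * r :=
            mul_le_mul_of_nonneg_left hp (by linarith [ht.2])
        _ < r := by nlinarith [ht.1]
    · have hcont : Continuous fun t : ℝ => dist s (AffineMap.lineMap c p t) :=
        continuous_const.dist AffineMap.lineMap_continuous
      refine (hcont.continuousAt.eventually_lt continuousAt_const ?_).filter_mono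
        nhdsWithin_le_nhds
      simpa using hlt s hs hsp
  obtain ⟨t, ht⟩ := hev.exists
  exact ⟨_, ht⟩

/-- If the radius `r` is at most that of every closed ball containing the nonempty finite set `S`,
then every center has a point of `S` at distance at least `r`. -/
theorem exists_le_dist_of_forall_subset_closedBall {E : Type*} [PseudoMetricSpace E]
    {S : Finset E} (hS : S.Nonempty) {r : ℝ}
    (hmin : ∀ (c' : E) (r' : ℝ), (↑S : Set E) ⊆ Metric.closedBall c' r' → r ≤ r') (c' : E) :
    ∃ s ∈ S, r ≤ dist s c' := by
  obtain ⟨s, hs, hmax⟩ := S.exists_max_image (fun s => dist s c') hS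
  exact ⟨s, hs, hmin c' _ fun x hx => Metric.mem_closedBall.2 (hmax x hx)⟩

/-- If a finite set `S` contains at least two distinct points and the
closed ball with center `c` and radius `r` is its smallest enclosing ball, then at
least two points of `S` lie on the boundary sphere of this ball. -/
theorem two_points_on_seb_boundary {d : ℕ}
    (S : Finset (EuclideanSpace ℝ (Fin d)))
    (htwo : ∃ a ∈ S, ∃ b ∈ S, a ≠ b)
    (c : EuclideanSpace ℝ (Fin d)) (r : ℝ)
    (hsub : (↑S : Set (EuclideanSpace ℝ (Fin d))) ⊆ Metric.closedBall c r)
    (hmin : ∀ (c' : EuclideanSpace ℝ (Fin d)) (r' : ℝ),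
      (↑S : Set (EuclideanSpace ℝ (Fin d))) ⊆ Metric.closedBall c' r' → r ≤ r') :
    ∃ s₁ ∈ S, ∃ s₂ ∈ S, s₁ ≠ s₂ ∧ dist c s₁ = r ∧ dist c s₂ = r := by
  obtain ⟨a, ha, b, hb, hab⟩ := htwo
  have hle : ∀ s ∈ S, dist s c ≤ r := fun s hs => Metric.mem_closedBall.1 (hsub hs)
  have hfar := exists_le_dist_of_forall_subset_closedBall ⟨a, ha⟩ hmin
  have hr : 0 < r := by
    have hpos := dist_pos.2 hab
    have htri := dist_triangle_right a b c
    linarith [hle a ha, hle b hb]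
  obtain ⟨p, hp, hpr⟩ := hfar c
  by_contra! hne
  obtain ⟨c', hc'⟩ := exists_center_forall_dist_lt S hr (hle p hp) fun s hs hsp =>
    lt_of_le_of_ne (hle s hs) fun hsr =>
      hne p hp s hs hsp.symm (by rw [dist_comm]; exact (hle p hp).antisymm hpr)
        (by rw [dist_comm]; exact hsr)
  obtain ⟨s, hs, hsr⟩ := hfar c'
  exact (hc' s hs).not_ge hsr
end

section
/- Let Q be a finite nonempty set of points in d-dimensional Euclidean space, let the closed ball with center c and radius r be the smallest enclosing ball of Q, let T = {q ∈ Q : dist(c, q) = r} be the points of Q on its boundary sphere, and let P ⊆ T be a maximal affinely independent subset of T (P affinely independent with affineSpan ℝ P = affineSpan ℝ T). Then c lies in the affine span of P and dist(c, p) = r for every p ∈ P; that is, the center of the smallest enclosing ball of Q equals the circumcenter of the simplex spanned by P. -/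
section SmallestEnclosingBall

open Filter Topology

/-- A finite set cannot lie in the open ball whose radius is a lower bound for the radii of all
closed balls enclosing the set. -/
theorem Set.Finite.exists_le_dist_of_forall_subset_closedBall {X : Type*} [PseudoMetricSpace X]
    {Q : Set X} (hfin : Q.Finite) (hne : Q.Nonempty) {r : ℝ}
    (hmin : ∀ (c' : X) (r' : ℝ), Q ⊆ Metric.closedBall c' r' → r ≤ r') (c : X) :
    ∃ q ∈ Q, r ≤ dist c q := by
  obtain ⟨q, hq, hmax⟩ := hfin.exists_maximalFor (dist c) Q hne
  refine ⟨q, hq, hmin c _ fun x hx => ?_⟩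
  rw [Metric.mem_closedBall, dist_comm]
  exact (le_total (dist c x) (dist c q)).elim id fun h => hmax hx h

/-- The center of a smallest enclosing ball of a finite set lies in the affine span of the points
of the set on the boundary sphere. -/
theorem mem_affineSpan_boundary_of_smallest_closedBall {V : Type*} [NormedAddCommGroup V]
    [InnerProductSpace ℝ V] [FiniteDimensional ℝ V] {Q : Set V} (hfin : Q.Finite)
    (hne : Q.Nonempty) {c : V} {r : ℝ} (hsub : Q ⊆ Metric.closedBall c r)
    (hmin : ∀ (c' : V) (r' : ℝ), Q ⊆ Metric.closedBall c' r' → r ≤ r') :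
    c ∈ affineSpan ℝ {q : V | q ∈ Q ∧ dist c q = r} := by
  have hle : ∀ q ∈ Q, dist c q ≤ r := fun q hq => by
    simpa [dist_comm] using hsub hq
  obtain ⟨p, hpQ, hp⟩ := hfin.exists_le_dist_of_forall_subset_closedBall hne hmin c
  have hpr : dist c p = r := le_antisymm (hle p hpQ) hp
  set A := affineSpan ℝ {q : V | q ∈ Q ∧ dist c q = r} with hA
  have hpA : p ∈ A := subset_affineSpan ℝ _ ⟨hpQ, hpr⟩
  obtain ⟨u, hu, v, hv, huv⟩ := A.direction.exists_add_mem_mem_orthogonal (p - c)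
  by_cases hv0 : v = 0
  · have hc : -u +ᵥ p ∈ A := AffineSubspace.vadd_mem_of_mem_direction (neg_mem hu) hpA
    have : -u +ᵥ p = c := by
      rw [← sub_eq_zero, vadd_eq_add, sub_eq_add_neg, add_assoc, ← sub_eq_add_neg, huv, hv0]
      simp
    rwa [this] at hc
  exfalso
  have hinner : ∀ q ∈ A, inner ℝ (q - c) v = ‖v‖ ^ 2 := fun q hq => by
    have hmem : q - p + u ∈ A.direction :=
      add_mem (AffineSubspace.vsub_mem_direction hq hpA) hu
    have hsplit : q - c = (q - p + u) + v := by
      rw [add_assoc, ← huv]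
      abel
    rw [hsplit, inner_add_left, Submodule.inner_right_of_mem_orthogonal hmem hv, zero_add,
      real_inner_self_eq_norm_sq]
  have hvpos : 0 < ‖v‖ ^ 2 := by positivity
  have hev : ∀ᶠ t : ℝ in 𝓝[>] 0, ∀ q ∈ Q, dist (c + t • v) q < r := by
    rw [eventually_all_finite hfin]
    intro q hq
    rcases (hle q hq).lt_or_eq with hlt | heq
    · have hcont : Continuous fun t : ℝ => dist (c + t • v) q := by fun_prop
      exact (hcont.tendsto 0).mono_left nhdsWithin_le_nhds |>.eventually_lt_const (by simpa using hlt)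
    · have hlt1 : ∀ᶠ t : ℝ in 𝓝[>] 0, t < 1 := nhdsWithin_le_nhds (eventually_lt_nhds one_pos)
      filter_upwards [hlt1, self_mem_nhdsWithin] with t ht1 ht0
      have ht0 : 0 < t := ht0
      have hqi := hinner q (subset_affineSpan ℝ _ ⟨hq, heq⟩)
      rw [← heq, dist_comm _ q, dist_comm _ q, dist_eq_norm, dist_eq_norm]
      refine lt_of_pow_lt_pow_left₀ 2 (norm_nonneg _) ?_
      rw [← sub_sub, norm_sub_sq_real, real_inner_smul_right, hqi, norm_smul, mul_pow,
        Real.norm_eq_abs, sq_abs]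
      nlinarith [mul_pos (mul_pos ht0 hvpos) (show 0 < 2 - t by linarith)]
  obtain ⟨t, ht⟩ := hev.exists
  obtain ⟨q, hq, hrq⟩ := hfin.exists_le_dist_of_forall_subset_closedBall hne hmin (c + t • v)
  exact (ht q hq).not_ge hrq

end SmallestEnclosingBall


/-- The center of the smallest enclosing ball of a finite nonempty set
`Q` equals the circumcenter of (the simplex spanned by) any maximal affinely
independent subset `P` of the set `T` of points of `Q` on the boundary sphere:
`c` lies in the affine span of `P` and is at distance `r` from every point of `P`. -/
theorem seb_center_is_circumcenter_of_boundary_simplex {d : ℕ}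
    (Q : Set (EuclideanSpace ℝ (Fin d))) (hfin : Q.Finite) (hne : Q.Nonempty)
    (c : EuclideanSpace ℝ (Fin d)) (r : ℝ)
    (hsub : Q ⊆ Metric.closedBall c r)
    (hmin : ∀ (c' : EuclideanSpace ℝ (Fin d)) (r' : ℝ),
      Q ⊆ Metric.closedBall c' r' → r ≤ r')
    (T : Set (EuclideanSpace ℝ (Fin d)))
    (hT : T = {q : EuclideanSpace ℝ (Fin d) | q ∈ Q ∧ dist c q = r})
    (P : Set (EuclideanSpace ℝ (Fin d))) (hPsub : P ⊆ T)
    (hindep : AffineIndependent ℝ ((↑) : P → EuclideanSpace ℝ (Fin d)))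
    (hspan : affineSpan ℝ P = affineSpan ℝ T) :
    c ∈ affineSpan ℝ P ∧ ∀ p ∈ P, dist c p = r := by
  subst hT
  refine ⟨?_, fun p hp => (hPsub hp).2⟩
  rw [hspan]
  exact mem_affineSpan_boundary_of_smallest_closedBall hfin hne hsub hmin
end

section
/- Let I ⊆ ℝ be an open interval and let p₀, p₁, …, p_k : ℝ → E be curves in d-dimensional Euclidean space, each differentiable on I, such that for every t ∈ I the points p₀(t), …, p_k(t) are affinely independent. Suppose ε : ℝ → E and ρ : ℝ → ℝ are functions such that for every t ∈ I, ε(t) lies in the affine span of {p₀(t), …, p_k(t)} and dist(ε(t), p_j(t)) = ρ(t) for all j (i.e. ε(t) is the circumcenter of the moving simplex). Then ε is differentiable on I. (This is the key case in the proof that the Euclidean 1-center function of a system of static points and mobile points with differentiable rational trajectories is piecewise differentiable.) -/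
/-- The determinant of a matrix with differentiable entries is differentiable. -/
theorem DifferentiableOn.matrix_det {𝕜 n : Type*} [NontriviallyNormedField 𝕜]
    [Fintype n] [DecidableEq n]
    {M : 𝕜 → Matrix n n 𝕜} {s : Set 𝕜}
    (hM : ∀ i j, DifferentiableOn 𝕜 (fun t => M t i j) s) :
    DifferentiableOn 𝕜 (fun t => (M t).det) s := by
  simp only [Matrix.det_apply']
  exact .fun_sum fun σ _ => (DifferentiableOn.fun_finsetProd fun i _ => hM (σ i) i).const_mul _

open scoped Matrix in
/-- The solution of a nonsingular linear system with differentiable coefficients and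
right-hand side is differentiable. -/
theorem DifferentiableOn.of_mulVec_eq {𝕜 n : Type*} [NontriviallyNormedField 𝕜]
    [Fintype n] [DecidableEq n]
    {M : 𝕜 → Matrix n n 𝕜} {c r : 𝕜 → n → 𝕜} {s : Set 𝕜}
    (hM : ∀ i j, DifferentiableOn 𝕜 (fun t => M t i j) s)
    (hr : ∀ i, DifferentiableOn 𝕜 (fun t => r t i) s)
    (hdet : ∀ t ∈ s, (M t).det ≠ 0) (hc : ∀ t ∈ s, M t *ᵥ c t = r t) (i : n) :
    DifferentiableOn 𝕜 (fun t => c t i) s := by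
  have hcramer : DifferentiableOn 𝕜 (fun t => (M t).cramer (r t) i) s := by
    simp only [Matrix.cramer_apply]
    refine DifferentiableOn.matrix_det fun j l => ?_
    by_cases hl : l = i
    · subst hl; simpa using hr j
    · simpa [Matrix.updateCol_ne hl] using hM j l
  refine (((DifferentiableOn.matrix_det hM).inv hdet).mul hcramer).congr fun t ht => ?_
  have h : (M t).cramer (r t) = (M t).det • c t := by
    rw [Matrix.cramer_eq_adjugate_mulVec, ← hc t ht, Matrix.mulVec_mulVec,
      Matrix.adjugate_mul, Matrix.smul_mulVec, Matrix.one_mulVec]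
  simp [h, hdet t ht]

/-- A point equidistant from `x` and `y` lies on their perpendicular bisector. -/
theorem inner_sub_sub_eq_of_dist_eq {V : Type*} [NormedAddCommGroup V]
    [InnerProductSpace ℝ V] {e x y : V} (h : dist e x = dist e y) :
    inner ℝ (y - x) (e - x) = ‖y - x‖ ^ 2 / 2 := by
  have h₁ := norm_sub_sq_real (y - x) (e - x)
  rw [sub_sub_sub_cancel_right, norm_sub_rev y e, ← dist_eq_norm e y, ← h,
    dist_eq_norm e x] at h₁
  linarith

/-- If `p 0, …, p k` are curves, differentiable on an open interval
`(a, b)`, whose values are affinely independent at every time of the interval, and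
`ε t` is the circumcenter of the moving simplex (the point of the affine span of the
`p j t` equidistant from all of them), then `ε` is differentiable on `(a, b)`. -/
theorem moving_circumcenter_differentiable {d k : ℕ} (a b : ℝ)
    (p : Fin (k + 1) → ℝ → EuclideanSpace ℝ (Fin d))
    (hdiff : ∀ j : Fin (k + 1), DifferentiableOn ℝ (p j) (Set.Ioo a b))
    (hindep : ∀ t ∈ Set.Ioo a b, AffineIndependent ℝ (fun j : Fin (k + 1) => p j t))
    (ε : ℝ → EuclideanSpace ℝ (Fin d)) (ρ : ℝ → ℝ)
    (hmem : ∀ t ∈ Set.Ioo a b,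
      ε t ∈ affineSpan ℝ (Set.range fun j : Fin (k + 1) => p j t))
    (hdist : ∀ t ∈ Set.Ioo a b, ∀ j : Fin (k + 1), dist (ε t) (p j t) = ρ t) :
    DifferentiableOn ℝ ε (Set.Ioo a b) := by
  let v : {j : Fin (k + 1) // j ≠ 0} → ℝ → EuclideanSpace ℝ (Fin d) :=
    fun j t => p j t - p 0 t
  have hv : ∀ j, DifferentiableOn ℝ (v j) (Set.Ioo a b) := fun j => (hdiff j).sub (hdiff 0)
  have hlin : ∀ t ∈ Set.Ioo a b, LinearIndependent ℝ (fun j => v j t) := by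
    intro t ht
    have h := (affineIndependent_iff_linearIndependent_vsub ℝ (fun j => p j t) 0).1 (hindep t ht)
    simpa only [vsub_eq_sub] using h
  have hcoeff : ∀ t, ∃ c : {j : Fin (k + 1) // j ≠ 0} → ℝ,
      t ∈ Set.Ioo a b → ∑ j, c j • v j t = ε t - p 0 t := by
    intro t
    by_cases ht : t ∈ Set.Ioo a b
    · have h := AffineSubspace.vsub_mem_direction (hmem t ht)
        (mem_affineSpan ℝ (Set.mem_range_self (f := fun j => p j t) 0))
      rw [direction_affineSpan, vectorSpan_range_eq_span_range_vsub_right_ne ℝ _ 0] at h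
      obtain ⟨c, hc⟩ := (Submodule.mem_span_range_iff_exists_fun ℝ).1 h
      exact ⟨c, fun _ => hc⟩
    · exact ⟨0, fun h => absurd h ht⟩
  choose c hc using hcoeff
  have hcdiff : ∀ j, DifferentiableOn ℝ (fun t => c t j) (Set.Ioo a b) := by
    refine DifferentiableOn.of_mulVec_eq (M := fun t => Matrix.gram ℝ fun j => v j t)
      (r := fun t i => ‖v i t‖ ^ 2 / 2) ?_ ?_ ?_ ?_
    · exact fun i j => (hv i).inner ℝ (hv j)
    · exact fun i => ((hv i).norm_sq ℝ).div_const 2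
    · exact fun t ht =>
        (Matrix.posDef_gram_of_linearIndependent (hlin t ht)).det_pos.ne'
    · intro t ht
      ext i
      have h := inner_sub_sub_eq_of_dist_eq ((hdist t ht 0).trans (hdist t ht i).symm)
      rw [← hc t ht, inner_sum] at h
      simpa [Matrix.mulVec, dotProduct, Matrix.gram_apply, inner_smul_right, mul_comm, v]
        using h
  have hsum : DifferentiableOn ℝ (fun t => ∑ j, c t j • v j t + p 0 t) (Set.Ioo a b) :=
    (DifferentiableOn.fun_sum fun j _ => (hcdiff j).smul (hv j)).add (hdiff 0)
  refine hsum.congr fun t ht => ?_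
  rw [hc t ht, sub_add_cancel]
end

section
/- Let T be a finite nonempty set of points in d-dimensional Euclidean space all lying on the sphere of center c and radius r (dist(c, t) = r for all t ∈ T). Then the closed ball with center c and radius r is the smallest enclosing ball of T if and only if c lies in the convex hull of T. -/
open scoped RealInnerProductSpace

section

variable {E : Type*} [NormedAddCommGroup E] [InnerProductSpace ℝ E]

/-- A point of the convex hull of `T` cannot have all of `T` strictly on one side of a hyperplane
through it. -/
theorem exists_inner_sub_nonpos_of_mem_convexHull {T : Set E} {c : E} (hc : c ∈ convexHull ℝ T)
    (v : E) : ∃ t ∈ T, ⟪v, t - c⟫ ≤ 0 := by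
  by_contra! h
  have hsub : T ⊆ {w | ⟪v, c⟫ < innerₗ E v w} := fun t ht => by
    have := h t ht
    rw [inner_sub_right] at this
    simpa using this
  have hmem := convexHull_min hsub (convex_halfSpace_gt (innerₗ E v).isLinear _) hc
  simp at hmem

/-- If the center of a sphere through `T` lies in the convex hull of `T`, then no ball of smaller
radius contains `T`. -/
theorem le_radius_of_center_mem_convexHull {T : Set E} {c c' : E} {r r' : ℝ}
    (hsphere : ∀ t ∈ T, dist c t = r) (hc : c ∈ convexHull ℝ T)
    (hT : T ⊆ Metric.closedBall c' r') : r ≤ r' := by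
  obtain ⟨t, ht, hle⟩ := exists_inner_sub_nonpos_of_mem_convexHull hc (c' - c)
  refine le_trans ?_ (Metric.mem_closedBall.1 (hT ht))
  rw [← hsphere t ht, dist_comm, dist_eq_norm, dist_eq_norm]
  refine le_of_sq_le_sq ?_ (norm_nonneg _)
  have h := norm_sub_sq_real (t - c) (c' - c)
  rw [sub_sub_sub_cancel_right, real_inner_comm] at h
  nlinarith [sq_nonneg ‖c' - c‖]

/-- Moving the center of a ball to the nearest point of a convex hull not containing it allows the
radius to shrink. -/
theorem exists_closedBall_lt_of_center_notMem_convexHull {T : Set E} (hfin : T.Finite)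
    (hne : T.Nonempty) {c : E} {r : ℝ} (hsphere : ∀ t ∈ T, dist c t = r)
    (hc : c ∉ convexHull ℝ T) : ∃ (c' : E) (r' : ℝ), T ⊆ Metric.closedBall c' r' ∧ r' < r := by
  obtain ⟨p, hp, hmin⟩ := exists_norm_eq_iInf_of_complete_convex hne.convexHull
    (hfin.isCompact_convexHull ℝ).isComplete (convex_convexHull ℝ T) c
  have hobtuse := (norm_eq_iInf_iff_real_inner_le_zero (convex_convexHull ℝ T) hp).1 hmin
  have hpos : 0 < ‖c - p‖ := norm_pos_iff.2 (sub_ne_zero.2 fun h => hc (h ▸ hp))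
  have hsq : ∀ t ∈ T, ‖t - p‖ ^ 2 ≤ r ^ 2 - ‖c - p‖ ^ 2 := fun t ht => by
    have h := norm_sub_sq_real (c - p) (t - p)
    rw [sub_sub_sub_cancel_right, ← dist_eq_norm c t, hsphere t ht] at h
    linarith [hobtuse t (subset_convexHull ℝ T ht)]
  obtain ⟨t, ht⟩ := hne
  have hr : 0 ≤ r := hsphere t ht ▸ dist_nonneg
  have hr_pos : 0 < r := by
    refine lt_of_le_of_ne hr fun h => ?_
    have := hsq t ht
    subst h
    nlinarith [sq_nonneg ‖t - p‖]
  refine ⟨p, √(r ^ 2 - ‖c - p‖ ^ 2), fun s hs => ?_, ?_⟩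
  · rw [Metric.mem_closedBall, dist_eq_norm]
    exact Real.le_sqrt_of_sq_le (hsq s hs)
  · rw [Real.sqrt_lt' hr_pos]
    linarith [pow_pos hpos 2]

end

/-- For a finite nonempty set `T` of points all lying on the sphere of
center `c` and radius `r`, the closed ball `closedBall c r` is the smallest enclosing
ball of `T` if and only if `c` lies in the convex hull of `T`. -/
theorem seb_of_cospherical_iff_center_mem_convexHull {d : ℕ}
    (T : Set (EuclideanSpace ℝ (Fin d))) (hfin : T.Finite) (hne : T.Nonempty)
    (c : EuclideanSpace ℝ (Fin d)) (r : ℝ)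
    (hsphere : ∀ t ∈ T, dist c t = r) :
    (T ⊆ Metric.closedBall c r ∧
      ∀ (c' : EuclideanSpace ℝ (Fin d)) (r' : ℝ),
        T ⊆ Metric.closedBall c' r' → r ≤ r')
    ↔ c ∈ convexHull ℝ T := by
  refine ⟨fun h => ?_, fun hc => ⟨fun t ht => ?_, fun c' r' hT =>
    le_radius_of_center_mem_convexHull hsphere hc hT⟩⟩
  · by_contra hc
    obtain ⟨c', r', hT, hlt⟩ :=
      exists_closedBall_lt_of_center_notMem_convexHull hfin hne hsphere hc
    exact absurd (h.2 c' r' hT) hlt.not_ge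
  · rw [Metric.mem_closedBall, dist_comm, hsphere t ht]
end
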